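/- arXiv:2512.15937 — 2 statements merged into one kernel-verified Lean document; each statement's English description precedes it below -/
import Mathlib

section
/- Let α, β, γ : ℝ → ℝ be continuous, and let u, f : [0,∞) × [0,∞) → ℂ be such that: (i) u is twice continuously differentiable in x and once in t, with ∂ₜ∂ₓₓu existing and jointly continuous; (ii) for every T > 0 there is an integrable function F : [0,∞) → ℝ dominating |∂ₓʲ∂ₜᵏ u(x,t)| and |f(x,t)| for all 0 ≤ t ≤ T, 0 ≤ j ≤ 2, 0 ≤ k ≤ 1; (iii) ∂ₓʲ u(x,t) → 0 as x → ∞ for j = 0, 1 and each t; (iv) u satisfies ∂ₜu(x,t) = α(t)·∂ₜ∂ₓₓu(x,t) + β(t)·∂ₓₓu(x,t) − γ(t)·u(x,t) + f(x,t) for all x > 0, t > 0. Define g₀(t) = u(0,t), g₁(t) = ∂ₓu(0,t), û(λ,t) = ∫₀^∞ u(x,t) e^{−iλx} dx, f̂(λ,t) = ∫₀^∞ f(x,t) e^{−iλx} dx, and Ω(λ,t) = ∫₀ᵗ (β(τ)λ² + γ(τ))/(1 + α(τ)λ²) dτ. Then for every real λ and every t ≥ 0: û(λ,t) = e^{−Ω(λ,t)}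 û(λ,0) − e^{−Ω(λ,t)} ∫₀ᵗ [e^{Ω(λ,τ)}/(1 + α(τ)λ²)] · ( α(τ)(g₁′(τ) + iλ g₀′(τ)) + β(τ)(g₁(τ) + iλ g₀(τ)) − f̂(λ,τ) ) dτ. -/
open MeasureTheory Filter Topology

lemma aux_norm (lam x : ℝ) : ‖Complex.exp (-(Complex.I * lam * x))‖ = 1 := by
  rw [Complex.norm_exp]; simp

lemma aux_contE (lam : ℝ) : Continuous (fun x : ℝ => Complex.exp (-(Complex.I * lam * x))) := by
  fun_prop

lemma aux_slice (g : ℝ → ℝ → ℂ) (lam : ℝ)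
    (hc : ContinuousOn (fun p : ℝ × ℝ => g p.1 p.2) (Set.Ici 0 ×ˢ Set.Ici 0))
    (t : ℝ) (ht : 0 ≤ t) :
    AEStronglyMeasurable (fun x : ℝ => g x t * Complex.exp (-(Complex.I * lam * x)))
      (volume.restrict (Set.Ici (0:ℝ))) := by
  have h1 : ContinuousOn (fun x : ℝ => g x t) (Set.Ici 0) := by
    have := hc.comp (f := fun x : ℝ => (x, t)) (s := Set.Ici 0) (by fun_prop)
      (fun x hx => ⟨hx, ht⟩)
    exact this
  exact (h1.mul (aux_contE lam).continuousOn).aestronglyMeasurable measurableSet_Ici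

lemma aux_int (g : ℝ → ℝ → ℂ) (lam : ℝ)
    (hc : ContinuousOn (fun p : ℝ × ℝ => g p.1 p.2) (Set.Ici 0 ×ˢ Set.Ici 0))
    (hd : ∀ T > (0:ℝ), ∃ F : ℝ → ℝ, IntegrableOn F (Set.Ici 0) ∧
        ∀ x ∈ Set.Ici (0:ℝ), ∀ t ∈ Set.Icc (0:ℝ) T, ‖g x t‖ ≤ F x)
    (t : ℝ) (ht : 0 ≤ t) :
    IntegrableOn (fun x : ℝ => g x t * Complex.exp (-(Complex.I * lam * x)))
      (Set.Ici (0:ℝ)) := by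
  obtain ⟨F, hF, hb⟩ := hd (t + 1) (by linarith)
  refine Integrable.mono' hF (aux_slice g lam hc t ht) ?_
  refine (ae_restrict_iff' measurableSet_Ici).2 (Eventually.of_forall fun x hx => ?_)
  rw [norm_mul, aux_norm, mul_one]
  exact hb x hx t ⟨ht, by linarith⟩

lemma aux_cont (g : ℝ → ℝ → ℂ) (lam : ℝ)
    (hc : ContinuousOn (fun p : ℝ × ℝ => g p.1 p.2) (Set.Ici 0 ×ˢ Set.Ici 0))
    (hd : ∀ T > (0:ℝ), ∃ F : ℝ → ℝ, IntegrableOn F (Set.Ici 0) ∧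
        ∀ x ∈ Set.Ici (0:ℝ), ∀ t ∈ Set.Icc (0:ℝ) T, ‖g x t‖ ≤ F x) :
    ContinuousOn (fun t : ℝ => ∫ x in Set.Ici (0:ℝ), g x t * Complex.exp (-(Complex.I * lam * x)))
      (Set.Ici 0) := by
  intro t ht
  obtain ⟨F, hF, hb⟩ := hd (t + 1) (by have := Set.mem_Ici.1 ht; linarith)
  have hev : ∀ᶠ s in 𝓝[Set.Ici 0] t, s ∈ Set.Ici (0:ℝ) ∧ s < t + 1 :=
    (eventually_mem_nhdsWithin).and
      (eventually_nhdsWithin_of_eventually_nhds (eventually_lt_nhds (by linarith)))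
  refine continuousWithinAt_of_dominated (bound := F) ?_ ?_ hF ?_
  · filter_upwards [hev] with s hs using aux_slice g lam hc s hs.1
  · filter_upwards [hev] with s hs
    refine (ae_restrict_iff' measurableSet_Ici).2 (Eventually.of_forall fun x hx => ?_)
    rw [norm_mul, aux_norm, mul_one]
    exact hb x hx s ⟨hs.1, hs.2.le⟩
  · refine (ae_restrict_iff' measurableSet_Ici).2 (Eventually.of_forall fun x hx => ?_)
    have h1 : ContinuousOn (fun s : ℝ => g x s) (Set.Ici 0) := by
      have := hc.comp (f := fun s : ℝ => (x, s)) (s := Set.Ici 0) (by fun_prop)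
        (fun s hs => ⟨hx, hs⟩)
      exact this
    exact (h1 t ht).mul continuousWithinAt_const

lemma aux_deriv (g g' : ℝ → ℝ → ℂ) (lam : ℝ)
    (hc : ContinuousOn (fun p : ℝ × ℝ => g p.1 p.2) (Set.Ici 0 ×ˢ Set.Ici 0))
    (hd : ∀ T > (0:ℝ), ∃ F : ℝ → ℝ, IntegrableOn F (Set.Ici 0) ∧
        ∀ x ∈ Set.Ici (0:ℝ), ∀ t ∈ Set.Icc (0:ℝ) T, ‖g x t‖ ≤ F x)
    (hc' : ContinuousOn (fun p : ℝ × ℝ => g' p.1 p.2) (Set.Ici 0 ×ˢ Set.Ici 0))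
    (hd' : ∀ T > (0:ℝ), ∃ F : ℝ → ℝ, IntegrableOn F (Set.Ici 0) ∧
        ∀ x ∈ Set.Ici (0:ℝ), ∀ t ∈ Set.Icc (0:ℝ) T, ‖g' x t‖ ≤ F x)
    (hg : ∀ x ∈ Set.Ici (0:ℝ), ∀ t ∈ Set.Ici (0:ℝ),
      HasDerivAt (fun t' => g x t') (g' x t) t)
    (t : ℝ) (ht : 0 < t) :
    HasDerivAt (fun t : ℝ => ∫ x in Set.Ici (0:ℝ), g x t * Complex.exp (-(Complex.I * lam * x)))
      (∫ x in Set.Ici (0:ℝ), g' x t * Complex.exp (-(Complex.I * lam * x))) t := by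
  obtain ⟨F, hF, hb⟩ := hd' (t + 1) (by linarith)
  have hs : Set.Ioo 0 (t + 1) ∈ 𝓝 t := Ioo_mem_nhds ht (by linarith)
  refine (hasDerivAt_integral_of_dominated_loc_of_deriv_le (bound := F)
    (μ := volume.restrict (Set.Ici (0:ℝ)))
    (F := fun t x => g x t * Complex.exp (-(Complex.I * lam * x)))
    (F' := fun t x => g' x t * Complex.exp (-(Complex.I * lam * x))) hs ?_
    (aux_int g lam hc hd t ht.le) (aux_slice g' lam hc' t ht.le) ?_ hF ?_).2
  · filter_upwards [hs] with s hs using aux_slice g lam hc s hs.1.le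
  · refine (ae_restrict_iff' measurableSet_Ici).2 (Eventually.of_forall fun x hx s hs => ?_)
    rw [norm_mul, aux_norm, mul_one]
    exact hb x hx s ⟨hs.1.le, hs.2.le⟩
  · refine (ae_restrict_iff' measurableSet_Ici).2 (Eventually.of_forall fun x hx s hs => ?_)
    exact (hg x hx s hs.1.le).mul_const _

lemma aux_ibp (v vx vxx : ℝ → ℂ) (lam : ℝ)
    (hv : ∀ x ∈ Set.Ici (0:ℝ), HasDerivAt v (vx x) x)
    (hvx : ∀ x ∈ Set.Ici (0:ℝ), HasDerivAt vx (vxx x) x)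
    (hi : IntegrableOn (fun x : ℝ => v x * Complex.exp (-(Complex.I * lam * x))) (Set.Ici (0:ℝ)))
    (hi2 : IntegrableOn (fun x : ℝ => vxx x * Complex.exp (-(Complex.I * lam * x)))
      (Set.Ici (0:ℝ)))
    (h0 : Tendsto v atTop (𝓝 0)) (h1 : Tendsto vx atTop (𝓝 0)) :
    (∫ x in Set.Ici (0:ℝ), vxx x * Complex.exp (-(Complex.I * lam * x))) =
      -(lam:ℂ)^2 * (∫ x in Set.Ici (0:ℝ), v x * Complex.exp (-(Complex.I * lam * x)))
      - (vx 0 + Complex.I * lam * v 0) := by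
  have hE : ∀ x : ℝ, HasDerivAt (fun x : ℝ => Complex.exp (-(Complex.I * lam * x)))
      (Complex.exp (-(Complex.I * lam * x)) * (-(Complex.I * lam))) x := by
    intro x
    have h : HasDerivAt (fun x : ℝ => -(Complex.I * lam * (x:ℂ))) (-(Complex.I * lam)) x := by
      refine ((Complex.ofRealCLM.hasDerivAt (x := x)).const_mul (Complex.I * lam)).neg.congr_deriv ?_
      simp
    exact h.cexp
  have hD : ∀ x ∈ Set.Ici (0:ℝ), HasDerivAt
      (fun x : ℝ => (vx x + Complex.I * lam * v x) * Complex.exp (-(Complex.I * lam * x)))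
      (vxx x * Complex.exp (-(Complex.I * lam * x))
        + (lam:ℂ)^2 * (v x * Complex.exp (-(Complex.I * lam * x)))) x := by
    intro x hx
    refine (((hvx x hx).add ((hv x hx).const_mul (Complex.I * lam))).mul (hE x)).congr_deriv ?_
    simp only [Pi.add_apply]
    linear_combination (-(lam:ℂ)^2 * v x * Complex.exp (-(Complex.I * lam * x))) * Complex.I_sq
  have hT : Tendsto (fun x : ℝ => (vx x + Complex.I * lam * v x) *
      Complex.exp (-(Complex.I * lam * x))) atTop (𝓝 0) := by
    rw [tendsto_zero_iff_norm_tendsto_zero]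
    simp only [norm_mul _ (Complex.exp _), aux_norm, mul_one]
    rw [← tendsto_zero_iff_norm_tendsto_zero]
    simpa using h1.add (h0.const_mul (Complex.I * lam))
  have hI := hi2.add (hi.const_mul ((lam:ℂ)^2))
  have key := integral_Ioi_of_hasDerivAt_of_tendsto
    (hD 0 Set.self_mem_Ici).continuousAt.continuousWithinAt
    (fun x hx => hD x (Set.Ioi_subset_Ici_self hx)) (hI.mono_set Set.Ioi_subset_Ici_self) hT
  rw [← integral_Ici_eq_integral_Ioi, integral_add hi2 (hi.const_mul _),
    integral_const_mul] at key
  simp at key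
  linear_combination key

/-- Global relation (2.6) for the pseudo-parabolic operator
    ∂ₜ − α(t)∂ₓₓ∂ₜ − β(t)∂ₓₓ + γ(t) on the half-line. -/
theorem stmt3
    (α β γ : ℝ → ℝ) (hα : Continuous α) (hβ : Continuous β) (hγ : Continuous γ)
    (hαnn : ∀ τ, 0 ≤ α τ)
    (u ux uxx ut utx utxx f : ℝ → ℝ → ℂ)
    -- (i) differentiability: twice in x, once in t, mixed derivative ∂ₜ∂ₓₓu exists
    (hux : ∀ t ∈ Set.Ici (0:ℝ), ∀ x ∈ Set.Ici (0:ℝ),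
      HasDerivAt (fun x' => u x' t) (ux x t) x)
    (huxx : ∀ t ∈ Set.Ici (0:ℝ), ∀ x ∈ Set.Ici (0:ℝ),
      HasDerivAt (fun x' => ux x' t) (uxx x t) x)
    (hut : ∀ x ∈ Set.Ici (0:ℝ), ∀ t ∈ Set.Ici (0:ℝ),
      HasDerivAt (fun t' => u x t') (ut x t) t)
    (hutx : ∀ x ∈ Set.Ici (0:ℝ), ∀ t ∈ Set.Ici (0:ℝ),
      HasDerivAt (fun t' => ux x t') (utx x t) t)
    (hutxx : ∀ x ∈ Set.Ici (0:ℝ), ∀ t ∈ Set.Ici (0:ℝ),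
      HasDerivAt (fun t' => uxx x t') (utxx x t) t)
    -- (i) joint continuity of u, its derivatives, and f
    (hcont : ∀ g ∈ [u, ux, uxx, ut, utx, utxx, f],
      ContinuousOn (fun p : ℝ × ℝ => g p.1 p.2) (Set.Ici 0 ×ˢ Set.Ici 0))
    -- (ii) uniform integrable domination on time strips
    (hdom : ∀ T > (0:ℝ), ∃ F : ℝ → ℝ, IntegrableOn F (Set.Ici 0) ∧
      ∀ g ∈ [u, ux, uxx, ut, utx, utxx, f],
        ∀ x ∈ Set.Ici (0:ℝ), ∀ t ∈ Set.Icc (0:ℝ) T, ‖g x t‖ ≤ F x)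
    -- (iii) decay of u and uₓ as x → ∞
    (hdecay : ∀ t ∈ Set.Ici (0:ℝ),
      Tendsto (fun x => u x t) atTop (𝓝 0) ∧ Tendsto (fun x => ux x t) atTop (𝓝 0))
    -- (iv) the PDE
    (hpde : ∀ x > (0:ℝ), ∀ t > (0:ℝ),
      ut x t = (α t : ℂ) * utxx x t + (β t : ℂ) * uxx x t - (γ t : ℂ) * u x t + f x t) :
    ∀ lam : ℝ, ∀ t ≥ (0:ℝ),
      (∫ x in Set.Ici (0:ℝ), u x t * Complex.exp (-(Complex.I * lam * x)))
        = Complex.exp (-(∫ τ in (0:ℝ)..t,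
              (((β τ * lam ^ 2 + γ τ) / (1 + α τ * lam ^ 2) : ℝ) : ℂ))) *
            (∫ x in Set.Ici (0:ℝ), u x 0 * Complex.exp (-(Complex.I * lam * x)))
          - Complex.exp (-(∫ τ in (0:ℝ)..t,
              (((β τ * lam ^ 2 + γ τ) / (1 + α τ * lam ^ 2) : ℝ) : ℂ))) *
            ∫ τ in (0:ℝ)..t,
              (Complex.exp (∫ s in (0:ℝ)..τ,
                  (((β s * lam ^ 2 + γ s) / (1 + α s * lam ^ 2) : ℝ) : ℂ)) /
                ((1 + α τ * lam ^ 2 : ℝ) : ℂ)) *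
              ((α τ : ℂ) * (utx 0 τ + Complex.I * lam * ut 0 τ)
                + (β τ : ℂ) * (ux 0 τ + Complex.I * lam * u 0 τ)
                - ∫ x in Set.Ici (0:ℝ), f x τ * Complex.exp (-(Complex.I * lam * x))) := by
  have hd : ∀ g ∈ [u, ux, uxx, ut, utx, utxx, f], ∀ T > (0:ℝ), ∃ F : ℝ → ℝ,
      IntegrableOn F (Set.Ici 0) ∧
        ∀ x ∈ Set.Ici (0:ℝ), ∀ t ∈ Set.Icc (0:ℝ) T, ‖g x t‖ ≤ F x := by
    intro g hg T hT
    obtain ⟨F, hF, hb⟩ := hdom T hT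
    exact ⟨F, hF, hb g hg⟩
  have mu : u ∈ [u, ux, uxx, ut, utx, utxx, f] := by simp
  have mux : ux ∈ [u, ux, uxx, ut, utx, utxx, f] := by simp
  have muxx : uxx ∈ [u, ux, uxx, ut, utx, utxx, f] := by simp
  have mut' : ut ∈ [u, ux, uxx, ut, utx, utxx, f] := by simp
  have mutx : utx ∈ [u, ux, uxx, ut, utx, utxx, f] := by simp
  have mutxx : utxx ∈ [u, ux, uxx, ut, utx, utxx, f] := by simp
  have mf : f ∈ [u, ux, uxx, ut, utx, utxx, f] := by simp
  intro lam t ht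
  have hbdry : ∀ g ∈ [u, ux, uxx, ut, utx, utxx, f],
      ContinuousOn (fun s : ℝ => g 0 s) (Set.Ici 0) := by
    intro g hg
    have := (hcont g hg).comp (f := fun s : ℝ => ((0:ℝ), s)) (s := Set.Ici 0) (by fun_prop)
      (fun s hs => ⟨Set.self_mem_Ici, hs⟩)
    exact this
  have hpos : ∀ τ, 0 < 1 + α τ * lam ^ 2 := fun τ => by
    have := mul_nonneg (hαnn τ) (sq_nonneg lam); linarith
  set U : ℝ → ℂ := fun s => ∫ x in Set.Ici (0:ℝ), u x s * Complex.exp (-(Complex.I * lam * x))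
    with hU
  set Ut : ℝ → ℂ := fun s => ∫ x in Set.Ici (0:ℝ), ut x s * Complex.exp (-(Complex.I * lam * x))
    with hUt
  set V : ℝ → ℂ := fun s => ∫ x in Set.Ici (0:ℝ), uxx x s * Complex.exp (-(Complex.I * lam * x))
    with hV
  set Vt : ℝ → ℂ := fun s => ∫ x in Set.Ici (0:ℝ), utxx x s * Complex.exp (-(Complex.I * lam * x))
    with hVt
  set fh : ℝ → ℂ := fun s => ∫ x in Set.Ici (0:ℝ), f x s * Complex.exp (-(Complex.I * lam * x))
    with hfh
  set w : ℝ → ℂ := fun τ => (((β τ * lam ^ 2 + γ τ) / (1 + α τ * lam ^ 2) : ℝ) : ℂ) with hw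
  set Om : ℝ → ℂ := fun s => ∫ τ in (0:ℝ)..s, w τ with hOm
  have hwc : Continuous w := by
    refine Complex.continuous_ofReal.comp (Continuous.div (by fun_prop) (by fun_prop) ?_)
    exact fun τ => (hpos τ).ne'
  have hOmd : ∀ s, HasDerivAt Om (w s) s := fun s =>
    intervalIntegral.integral_hasDerivAt_right (hwc.intervalIntegrable _ _)
      (hwc.stronglyMeasurableAtFilter _ _) hwc.continuousAt
  have hOmc : Continuous Om := continuous_iff_continuousAt.2 fun s => (hOmd s).continuousAt
  have hUc : ContinuousOn U (Set.Ici 0) := aux_cont u lam (hcont u mu) (hd u mu)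
  have hfc : ContinuousOn fh (Set.Ici 0) := aux_cont f lam (hcont f mf) (hd f mf)
  have hUd : ∀ s, 0 < s → HasDerivAt U (Ut s) s := fun s hs =>
    aux_deriv u ut lam (hcont u mu) (hd u mu) (hcont ut mut') (hd ut mut') hut s hs
  have hVd : ∀ s, 0 < s → HasDerivAt V (Vt s) s := fun s hs =>
    aux_deriv uxx utxx lam (hcont _ muxx) (hd _ muxx) (hcont _ mutxx) (hd _ mutxx) hutxx s hs
  have hVU : ∀ s, 0 ≤ s → V s = -(lam:ℂ)^2 * U s - (ux 0 s + Complex.I * lam * u 0 s) :=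
    fun s hs => aux_ibp (fun x => u x s) (fun x => ux x s) (fun x => uxx x s) lam
      (hux s hs) (huxx s hs) (aux_int u lam (hcont _ mu) (hd _ mu) s hs)
      (aux_int uxx lam (hcont _ muxx) (hd _ muxx) s hs) (hdecay s hs).1 (hdecay s hs).2
  have hVtU : ∀ s, 0 < s →
      Vt s = -(lam:ℂ)^2 * Ut s - (utx 0 s + Complex.I * lam * ut 0 s) := by
    intro s hs
    have h1 : HasDerivAt (fun s => -(lam:ℂ)^2 * U s - (ux 0 s + Complex.I * lam * u 0 s))
        (-(lam:ℂ)^2 * Ut s - (utx 0 s + Complex.I * lam * ut 0 s)) s :=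
      ((hUd s hs).const_mul _).sub ((hutx 0 Set.self_mem_Ici s hs.le).add
        ((hut 0 Set.self_mem_Ici s hs.le).const_mul _))
    refine (hVd s hs).unique (h1.congr_of_eventuallyEq ?_)
    filter_upwards [lt_mem_nhds hs] with r hr using hVU r hr.le
  have hP : ∀ s, 0 < s → Ut s = (α s : ℂ) * Vt s + (β s : ℂ) * V s - (γ s : ℂ) * U s + fh s := by
    intro s hs
    have iu := aux_int u lam (hcont _ mu) (hd _ mu) s hs.le
    have ixx := aux_int uxx lam (hcont _ muxx) (hd _ muxx) s hs.le
    have itxx := aux_int utxx lam (hcont _ mutxx) (hd _ mutxx) s hs.le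
    have jf := aux_int f lam (hcont _ mf) (hd _ mf) s hs.le
    simp only [hUt, hVt, hV, hU, hfh]
    have k1 := itxx.const_mul (α s : ℂ)
    have k2 := ixx.const_mul (β s : ℂ)
    have k3 := iu.const_mul (γ s : ℂ)
    rw [← integral_const_mul, ← integral_const_mul, ← integral_const_mul]
    refine Eq.trans ?_ ((integral_add ((k1.add k2).sub k3) jf).trans (congrArg (· + _)
      ((integral_sub (k1.add k2) k3).trans (congrArg (· - _) (integral_add k1 k2)))))
    rw [integral_Ici_eq_integral_Ioi, integral_Ici_eq_integral_Ioi]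
    refine setIntegral_congr_fun measurableSet_Ioi fun x hx => ?_
    simp only [hpde x hx s hs, Pi.add_apply, Pi.sub_apply]
    ring
  set R : ℝ → ℂ := fun τ => (Complex.exp (Om τ) / ((1 + α τ * lam ^ 2 : ℝ) : ℂ)) *
      ((α τ : ℂ) * (utx 0 τ + Complex.I * lam * ut 0 τ)
        + (β τ : ℂ) * (ux 0 τ + Complex.I * lam * u 0 τ) - fh τ) with hR
  have hRc : ContinuousOn R (Set.Ici 0) := by
    have c1 := hbdry _ mutx
    have c2 := hbdry _ mut'
    have c3 := hbdry _ mux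
    have c4 := hbdry _ mu
    have a1 : Continuous fun τ => Complex.exp (Om τ) / ((1 + α τ * lam ^ 2 : ℝ) : ℂ) := by
      refine Continuous.div (by fun_prop) (by fun_prop) fun τ => ?_
      exact_mod_cast (hpos τ).ne'
    have a2 : Continuous fun τ => (α τ : ℂ) := by fun_prop
    have a3 : Continuous fun τ => (β τ : ℂ) := by fun_prop
    exact a1.continuousOn.mul (((a2.continuousOn.mul (c1.add (continuousOn_const.mul c2))).add
      (a3.continuousOn.mul (c3.add (continuousOn_const.mul c4)))).sub hfc)
  have hfin : ∫ τ in (0:ℝ)..t, -R τ = Complex.exp (Om t) * U t - Complex.exp (Om 0) * U 0 := by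
    refine intervalIntegral.integral_eq_sub_of_hasDerivAt_of_le
      (f := fun s => Complex.exp (Om s) * U s) ht ?_ ?_ ?_
    · exact (by fun_prop : Continuous fun s => Complex.exp (Om s)).continuousOn.mul
        (hUc.mono Set.Icc_subset_Ici_self)
    · intro s hs
      refine ((hOmd s).cexp.mul (hUd s hs.1)).congr_deriv ?_
      have e := hP s hs.1
      rw [hVtU s hs.1, hVU s hs.1.le] at e
      have hne : ((1:ℂ) + α s * lam ^ 2) ≠ 0 := by exact_mod_cast (hpos s).ne'
      simp only [hR, hw]
      push_cast
      have e2 : Ut s = (-(β s * lam ^ 2 + γ s) * U s - ((α s : ℂ) *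
          (utx 0 s + Complex.I * lam * ut 0 s) + (β s : ℂ) * (ux 0 s + Complex.I * lam * u 0 s)
          - fh s)) / ((1:ℂ) + α s * lam ^ 2) := by
        rw [eq_div_iff hne]
        linear_combination e
      rw [e2]
      ring
    · refine ContinuousOn.intervalIntegrable ?_
      rw [Set.uIcc_of_le ht]
      exact (hRc.mono Set.Icc_subset_Ici_self).neg
  have hOm0 : Om 0 = 0 := by simp [hOm]
  rw [intervalIntegral.integral_neg, hOm0, Complex.exp_zero] at hfin
  change U t = Complex.exp (-Om t) * U 0 - Complex.exp (-Om t) * ∫ τ in (0:ℝ)..t, R τ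
  have hexp : Complex.exp (-Om t) * Complex.exp (Om t) = 1 := by
    rw [← Complex.exp_add]; simp
  linear_combination (-Complex.exp (-Om t)) * hfin - U t * hexp
end

section
/- Let α, β ∈ ℂ, set Π(x) = 1 + β·x² + α·x⁴, and suppose λ₁, μ ∈ ℂ satisfy Π(λ₁) = 0, Π(μ) = 0 and Π′(μ) ≠ 0. Then there exist an open neighborhood U ⊆ ℂ of λ₁ and a function σ : U → ℂ which is complex-differentiable (holomorphic) on U, such that σ(λ₁) = μ and λ·Π(σ(λ)) = σ(λ)·Π(λ) for all λ ∈ U. -/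
/-- Implicit-function-theorem step of Section 7: at a pair of zeros (λ₁, μ) of
    Π(x) = 1 + βx² + αx⁴ with Π′(μ) ≠ 0, there is a local holomorphic branch
    σ(λ) of the symmetry equation λΠ(σ(λ)) = σ(λ)Π(λ) with σ(λ₁) = μ. -/
theorem stmt15 (α β : ℂ) (P : ℂ → ℂ)
    (hP : ∀ x : ℂ, P x = 1 + β * x ^ 2 + α * x ^ 4)
    (lam₁ μ : ℂ) (h1 : P lam₁ = 0) (h2 : P μ = 0)
    (h3 : 2 * β * μ + 4 * α * μ ^ 3 ≠ 0) :
    ∃ U : Set ℂ, IsOpen U ∧ lam₁ ∈ U ∧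
      ∃ σ : ℂ → ℂ, DifferentiableOn ℂ σ U ∧ σ lam₁ = μ ∧
        ∀ lam ∈ U, lam * P (σ lam) = σ lam * P lam := by
  obtain rfl : P = fun x => 1 + β * x ^ 2 + α * x ^ 4 := funext hP
  have hl : lam₁ ≠ 0 := by
    rintro rfl
    simp at h1
  have hc : lam₁ * (2 * β * μ + 4 * α * μ ^ 3) ≠ 0 := mul_ne_zero hl h3
  let f : ℂ × ℂ → ℂ := fun p =>
    p.1 * (1 + β * p.2 ^ 2 + α * p.2 ^ 4) - p.2 * (1 + β * p.1 ^ 2 + α * p.1 ^ 4)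
  have cdf : ContDiffAt ℂ 1 f (lam₁, μ) := by
    have : ContDiff ℂ 1 f := by
      simp only [f]
      fun_prop
    exact this.contDiffAt
  have pn : (1 : WithTop ℕ∞) ≠ 0 := one_ne_zero
  have hfd : HasFDerivAt f (fderiv ℂ f (lam₁, μ)) (lam₁, μ) :=
    (cdf.differentiableAt pn).hasFDerivAt
  have hcomp : HasFDerivAt (fun y : ℂ => f (lam₁, y))
      (fderiv ℂ f (lam₁, μ) ∘L .inr ℂ ℂ ℂ) μ :=
    HasFDerivAt.comp (f := fun y : ℂ => (lam₁, y)) μ hfd (hasFDerivAt_prodMk_right lam₁ μ)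
  have hd : HasDerivAt (fun y : ℂ => f (lam₁, y)) (lam₁ * (2 * β * μ + 4 * α * μ ^ 3)) μ := by
    have e := ((((hasDerivAt_pow 2 μ).const_mul β).const_add 1).add
      ((hasDerivAt_pow 4 μ).const_mul α)).const_mul lam₁ |>.sub
      ((hasDerivAt_id μ).mul_const (1 + β * lam₁ ^ 2 + α * lam₁ ^ 4))
    refine e.congr_deriv ?_
    simp only at h1
    rw [h1]
    push_cast
    ring
  have if₂ : (fderiv ℂ f (lam₁, μ) ∘L .inr ℂ ℂ ℂ).IsInvertible := by
    refine ⟨ContinuousLinearEquiv.unitsEquivAut ℂ (Units.mk0 _ hc), ?_⟩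
    rw [hcomp.unique hd.hasFDerivAt]
    ext
    simp
  have hf0 : f (lam₁, μ) = 0 := by
    simp only at h1 h2
    simp only [f, h1, h2]
    ring
  have ev1 := cdf.eventually_apply_implicitFunction pn if₂
  have ev2 := (cdf.contDiffAt_implicitFunction pn if₂).eventually (by simp)
  obtain ⟨U, hU, hUo, hmem⟩ := eventually_nhds_iff.1 (ev1.and ev2)
  refine ⟨U, hUo, hmem, cdf.implicitFunction pn if₂, ?_,
    cdf.implicitFunction_apply_self pn if₂, ?_⟩
  · intro x hx
    exact ((hU x hx).2.differentiableAt pn).differentiableWithinAt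
  · intro x hx
    have := (hU x hx).1
    rw [hf0] at this
    exact sub_eq_zero.1 this
end
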